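/- arXiv:2503.05183 — 6 statements merged into one kernel-verified Lean document; each statement's English description precedes it below -/
import Mathlib

section
/- Let L be a real n1×n2 matrix and let r be an integer with rank(L) ≤ r ≤ min{n1, n2}. Then rank(L) = min{ ‖Z‖_{F,0} : Z ∈ ℝ^{n2×r} and there exists D ∈ ℝ^{n1×r} with DᵀD = I_r and L = D Zᵀ }. (Matrix, i.e. single-frontal-slice, case of the paper's Theorem 3.1 equating tubal rank with minimal group sparsity over orthonormal factorizations.) -/
open scoped Matrix

/-- Euclidean norm of the `j`-th column of a real matrix. -/
noncomputable def colNorm {n r : ℕ} (Z : Matrix (Fin n) (Fin r) ℝ) (j : Fin r) : ℝ :=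
  Real.sqrt (∑ i, (Z i j) ^ 2)

/-- Column sparsity `‖Z‖_{F,0}`: the number of nonzero columns of `Z`. -/
noncomputable def colSparsity {n r : ℕ} (Z : Matrix (Fin n) (Fin r) ℝ) : ℕ :=
  {j : Fin r | (fun i => Z i j) ≠ 0}.ncard

/-- Frobenius norm of a real matrix. -/
noncomputable def frobNorm {n r : ℕ} (X : Matrix (Fin n) (Fin r) ℝ) : ℝ :=
  Real.sqrt (∑ i, ∑ j, (X i j) ^ 2)

/-- `Ω`: matrices `Z` admitting an orthonormal factor `D` with `DᵀD = I` and `L = D Zᵀ`. -/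
def Omega {n1 n2 : ℕ} (r : ℕ) (L : Matrix (Fin n1) (Fin n2) ℝ) :
    Set (Matrix (Fin n2) (Fin r) ℝ) :=
  {Z | ∃ D : Matrix (Fin n1) (Fin r) ℝ, Dᵀ * D = 1 ∧ L = D * Zᵀ}

/-- `Q^s`: matrices with at most `s` nonzero columns. -/
def Qset (n r : ℕ) (s : ℕ) : Set (Matrix (Fin n) (Fin r) ℝ) :=
  {Z | colSparsity Z ≤ s}

/-- Frobenius distance from `Z` to the set `Q^s`. -/
noncomputable def distQ {n r : ℕ} (Z : Matrix (Fin n) (Fin r) ℝ) (s : ℕ) : ℝ :=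
  sInf {d : ℝ | ∃ Z' ∈ Qset n r s, d = frobNorm (Z - Z')}

/-- `ψ` is admissible for `ν`: `ψ(0)=0`, `x/ν ≤ ψ(x) < 1` on `(0,ν)`, `ψ(x)=1` on `[ν,∞)`. -/
def Admissible (ν : ℝ) (ψ : ℝ → ℝ) : Prop :=
  ψ 0 = 0 ∧ (∀ x : ℝ, 0 < x → x < ν → x / ν ≤ ψ x ∧ ψ x < 1) ∧ ∀ x : ℝ, ν ≤ x → ψ x = 1

/-- `‖Z‖_{F,1}^ψ = Σ_j ψ(‖Z(:,j)‖₂)`. -/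
noncomputable def psiNorm {n r : ℕ} (ψ : ℝ → ℝ) (Z : Matrix (Fin n) (Fin r) ℝ) : ℝ :=
  ∑ j, ψ (colNorm Z j)

/-- The rank of a product `D * Zᵀ` is at most the number of nonzero columns of `Z`. -/
theorem rank_mul_transpose_le_colSparsity {m n r : ℕ} (D : Matrix (Fin m) (Fin r) ℝ)
    (Z : Matrix (Fin n) (Fin r) ℝ) : (D * Zᵀ).rank ≤ colSparsity Z := by
  classical
  refine (Matrix.rank_mul_le_right D Zᵀ).trans ?_
  rw [colSparsity, Set.ncard_eq_toFinset_card']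
  refine Matrix.rank_le_card_of_support_subset _ _ fun j hj => ?_
  simpa using! hj

/-- A subspace of `ℝⁿ` of dimension `k` is spanned by the first `k` vectors of some orthonormal
basis: the remaining basis vectors are orthogonal to it. -/
theorem exists_orthonormalBasis_inner_eq_zero {n : ℕ}
    (W : Submodule ℝ (EuclideanSpace ℝ (Fin n))) :
    ∃ c : OrthonormalBasis (Fin n) ℝ (EuclideanSpace ℝ (Fin n)),
      ∀ j : Fin n, Module.finrank ℝ W ≤ j → ∀ x ∈ W, inner ℝ (c j) x = 0 := by
  set k := Module.finrank ℝ W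
  have hkn : k ≤ n := by simpa using W.finrank_le
  let b : OrthonormalBasis (Fin k) ℝ W := stdOrthonormalBasis ℝ W
  let v : Fin n → EuclideanSpace ℝ (Fin n) := fun j => if h : (j : ℕ) < k then b ⟨j, h⟩ else 0
  have hv : Orthonormal ℝ (({j : Fin n | (j : ℕ) < k}).domRestrict v) := by
    have hb := (b.orthonormal.comp_linearIsometry W.subtypeₗᵢ).comp
      (fun j : {j : Fin n | (j : ℕ) < k} => (⟨j.1, j.2⟩ : Fin k))
      (fun i j h => Subtype.ext (Fin.ext (Fin.mk.inj h)))
    convert hb using 1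
    ext1 j
    exact dif_pos j.2
  obtain ⟨c, hc⟩ := hv.exists_orthonormalBasis_extension_of_card_eq (by simp)
  refine ⟨c, fun j hj x hx => ?_⟩
  have hbc (i : Fin k) : (b i : EuclideanSpace ℝ (Fin n)) = c (Fin.castLE hkn i) := by
    rw [hc (Fin.castLE hkn i) i.isLt]
    simp [v]
  have hx' := congrArg W.subtype (b.sum_repr ⟨x, hx⟩)
  simp only [map_sum, map_smul, Submodule.subtype_apply] at hx'
  rw [← hx', inner_sum]
  refine Finset.sum_eq_zero fun i _ => ?_
  rw [inner_smul_right, hbc, c.inner_eq_zero, mul_zero]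
  rintro rfl
  simp at hj
  omega

/-- Every real matrix with rank at most `r` is fixed by `D * Dᵀ` for some `D` with `r` orthonormal
columns such that all but the first `rank` rows of `Dᵀ * L` vanish. -/
theorem exists_orthonormal_factor {m n r : ℕ} (L : Matrix (Fin m) (Fin n) ℝ)
    (hLr : L.rank ≤ r) (hrm : r ≤ m) :
    ∃ D : Matrix (Fin m) (Fin r) ℝ, Dᵀ * D = 1 ∧ D * (Dᵀ * L) = L ∧
      ∀ j : Fin r, L.rank ≤ j → ∀ i, (Dᵀ * L) j i = 0 := by
  let e := (WithLp.linearEquiv 2 ℝ (Fin m → ℝ)).symm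
  let W := (Submodule.span ℝ (Set.range L.col)).map (e : (Fin m → ℝ) →ₗ[ℝ] EuclideanSpace ℝ (Fin m))
  have hW : Module.finrank ℝ W = L.rank := by
    rw [L.rank_eq_finrank_span_cols]
    exact e.finrank_map_eq _
  obtain ⟨c, hc⟩ := exists_orthonormalBasis_inner_eq_zero W
  have hcol (i : Fin n) : e (L.col i) ∈ W :=
    Submodule.mem_map_of_mem (Submodule.subset_span ⟨i, rfl⟩)
  let D : Matrix (Fin m) (Fin r) ℝ := .of fun i j => c (Fin.castLE hrm j) i
  have hDL (j : Fin r) (i : Fin n) :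
      (Dᵀ * L) j i = inner ℝ (c (Fin.castLE hrm j)) (e (L.col i)) := by
    simp [D, e, Matrix.mul_apply, PiLp.inner_apply, mul_comm]
  refine ⟨D, ?_, ?_, fun j hj i => ?_⟩
  · ext i j
    have h := orthonormal_iff_ite.mp c.orthonormal (Fin.castLE hrm i) (Fin.castLE hrm j)
    simpa [D, Matrix.mul_apply, PiLp.inner_apply, Matrix.one_apply, mul_comm] using h
  · ext a i
    have h := congrArg (fun x : EuclideanSpace ℝ (Fin m) => x a) (c.sum_repr' (e (L.col i)))
    simp only [WithLp.ofLp_sum, Finset.sum_apply, PiLp.smul_apply, smul_eq_mul] at h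
    rw [Matrix.mul_apply]
    refine Eq.trans ?_ h
    refine Fintype.sum_of_injective (Fin.castLE hrm) (Fin.castLE_injective hrm) _ _
      (fun j hj => ?_) fun j => ?_
    · rw [hc j _ _ (hcol i), zero_mul]
      rw [hW]
      by_contra! hlt
      exact hj ⟨⟨j, hlt.trans_le hLr⟩, rfl⟩
    · rw [hDL, mul_comm]
      rfl
  · rw [hDL]
    exact hc _ (by simpa [hW] using hj) _ (hcol i)

/-- Matrix case of Theorem 3.1: `rank(L)` equals the minimum of the column sparsity
`‖Z‖_{F,0}` over all factorizations `L = D Zᵀ` with `DᵀD = I_r`, whenever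
`rank(L) ≤ r ≤ min{n1, n2}`. -/
theorem rank_eq_min_colSparsity {n1 n2 r : ℕ} (L : Matrix (Fin n1) (Fin n2) ℝ)
    (hr1 : L.rank ≤ r) (hr2 : r ≤ min n1 n2) :
    IsLeast {k : ℕ | ∃ (D : Matrix (Fin n1) (Fin r) ℝ) (Z : Matrix (Fin n2) (Fin r) ℝ),
      Dᵀ * D = 1 ∧ L = D * Zᵀ ∧ k = colSparsity Z} L.rank := by
  constructor
  · obtain ⟨D, hD, hDL, hzero⟩ := exists_orthonormal_factor L hr1 (hr2.trans (min_le_left _ _))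
    have hL : L = D * (Dᵀ * L)ᵀᵀ := by rw [Matrix.transpose_transpose, hDL]
    refine ⟨D, (Dᵀ * L)ᵀ, hD, hL, le_antisymm ?_ ?_⟩
    · conv_lhs => rw [hL]
      exact rank_mul_transpose_le_colSparsity D _
    · have hsub : {j : Fin r | (fun i => (Dᵀ * L)ᵀ i j) ≠ 0} ⊆
          Set.range (Fin.castLE hr1) := fun j hj => by
        by_contra hlt
        refine hj (funext fun i => hzero j ?_ i)
        by_contra! h
        exact hlt ⟨⟨j, h⟩, rfl⟩
      refine (Set.ncard_le_ncard hsub).trans ?_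
      rw [← Set.image_univ]
      exact (Set.ncard_image_le Set.finite_univ).trans (by simp)
  · rintro _ ⟨D, Z, -, hL, rfl⟩
    conv_lhs => rw [hL]
    exact rank_mul_transpose_le_colSparsity D Z
end

section
/- Let L ∈ ℝ^{n1×n2}, let r be an integer with rank(L) ≤ r ≤ min{n1, n2}, and let N := min{ ‖Z‖_{F,0} : Z ∈ Ω }. There exists ν̄ > 0 such that for every ν with 0 < ν < ν̄ and every function ψ admissible for ν, the minimum of ‖Z‖_{F,1}^ψ over Z ∈ Ω is attained and equals N. (Equality of optimal values in the matrix, i.e. single-frontal-slice, case of Theorem 3.2.) -/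
open scoped Matrix

open Filter Topology

theorem colNorm_nonneg {n r : ℕ} (Z : Matrix (Fin n) (Fin r) ℝ) (j : Fin r) :
    0 ≤ colNorm Z j :=
  Real.sqrt_nonneg _

theorem colNorm_eq_zero_iff {n r : ℕ} (Z : Matrix (Fin n) (Fin r) ℝ) (j : Fin r) :
    colNorm Z j = 0 ↔ (fun i => Z i j) = 0 := by
  unfold colNorm
  rw [Real.sqrt_eq_zero (Finset.sum_nonneg fun i _ => sq_nonneg _),
    Finset.sum_eq_zero_iff_of_nonneg fun i _ => sq_nonneg _]
  simp [funext_iff]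

theorem continuous_colNorm {n r : ℕ} (j : Fin r) :
    Continuous fun Z : Matrix (Fin n) (Fin r) ℝ => colNorm Z j := by
  unfold colNorm
  fun_prop

theorem colSparsity_eq_card {n r : ℕ} (Z : Matrix (Fin n) (Fin r) ℝ) :
    colSparsity Z = (Finset.univ.filter fun j => 0 < colNorm Z j).card := by
  rw [colSparsity, ← Set.ncard_coe_finset]
  congr 1
  ext j
  simp [(colNorm_nonneg Z j).lt_iff_ne', colNorm_eq_zero_iff]

theorem Admissible.nonneg {ν : ℝ} {ψ : ℝ → ℝ} (hν : 0 < ν) (hψ : Admissible ν ψ) {x : ℝ}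
    (hx : 0 ≤ x) : 0 ≤ ψ x := by
  obtain ⟨h0, h1, h2⟩ := hψ
  rcases hx.eq_or_lt with rfl | hx
  · exact h0.ge
  · rcases lt_or_ge x ν with h | h
    · exact (div_pos hx hν).le.trans (h1 x hx h).1
    · simp [h2 x h]

theorem Admissible.le_one {ν : ℝ} {ψ : ℝ → ℝ} (hψ : Admissible ν ψ) {x : ℝ}
    (hx : 0 ≤ x) : ψ x ≤ 1 := by
  obtain ⟨h0, h1, h2⟩ := hψ
  rcases hx.eq_or_lt with rfl | hx
  · simp [h0]
  · rcases lt_or_ge x ν with h | h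
    · exact (h1 x hx h).2.le
    · exact (h2 x h).le

theorem psiNorm_le_colSparsity {n r : ℕ} {ν : ℝ} {ψ : ℝ → ℝ} (hψ : Admissible ν ψ)
    (Z : Matrix (Fin n) (Fin r) ℝ) : psiNorm ψ Z ≤ colSparsity Z := by
  rw [psiNorm, colSparsity_eq_card, Finset.card_filter]
  push_cast
  refine Finset.sum_le_sum fun j _ => ?_
  split_ifs with h
  · exact hψ.le_one h.le
  · simp [le_antisymm (not_lt.1 h) (colNorm_nonneg Z j), hψ.1]

theorem card_le_psiNorm {n r : ℕ} {ν : ℝ} {ψ : ℝ → ℝ} (hν : 0 < ν) (hψ : Admissible ν ψ)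
    (Z : Matrix (Fin n) (Fin r) ℝ) :
    ((Finset.univ.filter fun j => ν < colNorm Z j).card : ℝ) ≤ psiNorm ψ Z := by
  rw [psiNorm, Finset.card_filter]
  push_cast
  refine Finset.sum_le_sum fun j _ => ?_
  split_ifs with h
  · exact (hψ.2.2 _ h.le).ge
  · exact hψ.nonneg hν (colNorm_nonneg Z j)

theorem isCompact_transpose_mul_self_eq_one (m r : ℕ) :
    IsCompact {D : Matrix (Fin m) (Fin r) ℝ | Dᵀ * D = 1} := by
  refine IsCompact.of_isClosed_subset
    (isCompact_univ_pi fun _ : Fin m => isCompact_univ_pi fun _ : Fin r =>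
      isCompact_Icc (a := (-1 : ℝ)) (b := 1))
    (isClosed_eq (by fun_prop) continuous_const) fun D hD i _ j _ => ?_
  have h : ∑ k, D k j * D k j = 1 := by
    simpa [Matrix.mul_apply] using congrFun (congrFun (hD : Dᵀ * D = 1) j) j
  have hij := Finset.single_le_sum (f := fun k => D k j * D k j)
    (fun k _ => mul_self_nonneg _) (Finset.mem_univ i)
  rw [h] at hij
  exact abs_le.1 (abs_le_one_iff_mul_self_le_one.2 hij)

theorem isCompact_Omega {n1 n2 : ℕ} (r : ℕ) (L : Matrix (Fin n1) (Fin n2) ℝ) :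
    IsCompact (Omega r L) := by
  have hc : IsCompact ({D : Matrix (Fin n1) (Fin r) ℝ | Dᵀ * D = 1} ∩
      {D | L = D * (Lᵀ * D)ᵀ}) :=
    (isCompact_transpose_mul_self_eq_one n1 r).inter_right
      (isClosed_eq continuous_const (by fun_prop))
  convert hc.image (f := fun D => Lᵀ * D) (by fun_prop) using 1
  ext Z
  constructor
  · rintro ⟨D, hD, hL⟩
    have hZ : Lᵀ * D = Z := by
      rw [hL, Matrix.transpose_mul, Matrix.transpose_transpose, Matrix.mul_assoc, hD,
        Matrix.mul_one]
    exact ⟨D, ⟨hD, by simpa only [Set.mem_ofPred_eq, hZ] using hL⟩, hZ⟩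
  · rintro ⟨D, ⟨hD, hL⟩, rfl⟩
    exact ⟨D, hD, hL⟩

/-- On a compact set of matrices with at least `N` nonzero columns, some uniform positive
threshold is exceeded by at least `N` column norms. -/
theorem exists_pos_card_colNorm_gt {n r N : ℕ} {K : Set (Matrix (Fin n) (Fin r) ℝ)}
    (hK : IsCompact K) (hN : ∀ Z ∈ K, N ≤ colSparsity Z) :
    ∃ δ : ℝ, 0 < δ ∧ ∀ Z ∈ K, N ≤ (Finset.univ.filter fun j => δ < colNorm Z j).card := by
  refine hK.induction_on (p := fun s => ∃ δ : ℝ, 0 < δ ∧ ∀ Z ∈ s,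
    N ≤ (Finset.univ.filter fun j => δ < colNorm Z j).card) ⟨1, one_pos, by simp⟩ ?_ ?_ ?_
  · rintro s t hst ⟨δ, hδ, h⟩
    exact ⟨δ, hδ, fun Z hZ => h Z (hst hZ)⟩
  · rintro s t ⟨δ, hδ, hs⟩ ⟨ε, hε, ht⟩
    refine ⟨min δ ε, lt_min hδ hε, ?_⟩
    rintro Z (hZ | hZ)
    · exact (hs Z hZ).trans (Finset.card_le_card (Finset.monotone_filter_right _
        fun j _ hj => (min_le_left _ _).trans_lt hj))
    · exact (ht Z hZ).trans (Finset.card_le_card (Finset.monotone_filter_right _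
        fun j _ hj => (min_le_right _ _).trans_lt hj))
  · intro Z hZ
    have hδ : ∀ᶠ δ in 𝓝[>] (0 : ℝ), ∀ j, 0 < colNorm Z j → δ < colNorm Z j :=
      eventually_all.2 fun j => by
        by_cases hj : 0 < colNorm Z j
        · filter_upwards [Ioo_mem_nhdsGT hj] with δ h _ using h.2
        · simp [hj]
    obtain ⟨δ, h, hpos⟩ := (hδ.and self_mem_nhdsWithin).exists
    have hnhds : ∀ᶠ Y in 𝓝 Z, ∀ j, 0 < colNorm Z j → δ < colNorm Y j :=
      eventually_all.2 fun j => by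
        by_cases hj : 0 < colNorm Z j
        · filter_upwards [(continuous_colNorm j).continuousAt.eventually_const_lt (h j hj)]
            with Y hY _ using hY
        · simp [hj]
    refine ⟨_, mem_nhdsWithin_of_mem_nhds hnhds, δ, hpos, fun Y hY => ?_⟩
    refine (hN Z hZ).trans ?_
    rw [colSparsity_eq_card]
    exact Finset.card_le_card (Finset.monotone_filter_right _ fun j _ hj => hY j hj)

/-- Equality of optimal values in the matrix case of Theorem 3.2: with
`N = min{‖Z‖_{F,0} : Z ∈ Ω}`, there is `ν̄ > 0` such that for every `0 < ν < ν̄` and every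
`ψ` admissible for `ν`, the minimum of `‖Z‖_{F,1}^ψ` over `Ω` is attained and equals `N`. -/
theorem psiNorm_min_eq_sparsity_min {n1 n2 r : ℕ} (L : Matrix (Fin n1) (Fin n2) ℝ)
    (hr1 : L.rank ≤ r) (hr2 : r ≤ min n1 n2)
    (N : ℕ) (hN : IsLeast {k : ℕ | ∃ Z ∈ Omega r L, k = colSparsity Z} N) :
    ∃ νbar : ℝ, 0 < νbar ∧ ∀ ν : ℝ, 0 < ν → ν < νbar → ∀ ψ : ℝ → ℝ, Admissible ν ψ →
      IsLeast {v : ℝ | ∃ Z ∈ Omega r L, v = psiNorm ψ Z} (N : ℝ) := by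
  obtain ⟨⟨Z, hZ, hNZ⟩, hle⟩ := hN
  obtain ⟨δ, hδ, hcard⟩ := exists_pos_card_colNorm_gt (isCompact_Omega r L)
    fun Y hY => hle ⟨Y, hY, rfl⟩
  refine ⟨δ, hδ, fun ν hν hνδ ψ hψ => ?_⟩
  have hlower : ∀ Y ∈ Omega r L, (N : ℝ) ≤ psiNorm ψ Y := fun Y hY => by
    refine le_trans ?_ (card_le_psiNorm hν hψ Y)
    exact_mod_cast (hcard Y hY).trans (Finset.card_le_card
      (Finset.monotone_filter_right _ fun j _ hj => hνδ.trans hj))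
  refine ⟨⟨Z, hZ, (hlower Z hZ).antisymm ?_⟩, ?_⟩
  · rw [hNZ]
    exact psiNorm_le_colSparsity hψ Z
  · rintro _ ⟨Y, hY, rfl⟩
    exact hlower Y hY
end

section
/- Let 0 < p < 1, λ > 0, and z ∈ ℝ. If x* ∈ ℝ is a global minimizer of the function h(x) = λ|x|^p + (1/2)(x − z)², then either x* = 0 or |x*| ≥ (2λ(1−p))^{1/(2−p)}. (Lower threshold for the proximal operator of the ℓ^p penalty, used in the closed-form update (opt:Z) and in the proof of Theorem 3.8.) -/
/-- First-order condition along the ray through a minimizer. -/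
theorem lp_prox_stationary {p lam z x : ℝ}
    (hmin : ∀ y : ℝ, lam * |x| ^ p + (1 / 2) * (x - z) ^ 2 ≤
      lam * |y| ^ p + (1 / 2) * (y - z) ^ 2) :
    lam * p * |x| ^ p + (x - z) * x = 0 := by
  have hlocal : IsLocalMin
      (fun t : ℝ => lam * (t ^ p * |x| ^ p) + (1 / 2) * (t * x - z) ^ 2) 1 := by
    filter_upwards [lt_mem_nhds (zero_lt_one (α := ℝ))] with t ht
    have h := hmin (t * x)
    rw [abs_mul, abs_of_pos ht, Real.mul_rpow ht.le (abs_nonneg x)] at h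
    simpa using h
  have hpow : HasDerivAt (fun t : ℝ => t ^ p) p 1 := by
    simpa using Real.hasDerivAt_rpow_const (x := 1) (p := p) (Or.inl one_ne_zero)
  have hderiv := ((hpow.mul_const (|x| ^ p)).const_mul lam).add
    (((((hasDerivAt_id (1 : ℝ)).mul_const x).sub_const z).pow 2).const_mul (1 / 2))
  have h := hlocal.hasDerivAt_eq_zero hderiv
  norm_num at h
  linarith

/-- Lower threshold for the proximal operator of the `ℓ^p` penalty (used in update
(opt:Z) and in the proof of Theorem 3.8): if `x*` globally minimizes
`h(x) = λ|x|^p + (1/2)(x − z)²` with `0 < p < 1` and `λ > 0`, then `x* = 0` or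
`|x*| ≥ (2λ(1−p))^{1/(2−p)}`. -/
theorem lp_prox_threshold (p lam z : ℝ) (hp0 : 0 < p) (hp1 : p < 1) (hlam : 0 < lam)
    (xstar : ℝ)
    (hmin : ∀ x : ℝ, lam * |xstar| ^ p + (1 / 2) * (xstar - z) ^ 2 ≤
      lam * |x| ^ p + (1 / 2) * (x - z) ^ 2) :
    xstar = 0 ∨ (2 * lam * (1 - p)) ^ ((1 : ℝ) / (2 - p)) ≤ |xstar| := by
  rcases eq_or_ne xstar 0 with hx | hx
  · exact Or.inl hx
  right
  have hpos : 0 < |xstar| := abs_pos.mpr hx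
  have hstat := lp_prox_stationary hmin
  have hzero := hmin 0
  rw [abs_zero, Real.zero_rpow hp0.ne'] at hzero
  have hle : 2 * lam * (1 - p) ≤ |xstar| ^ (2 - p) := by
    rw [Real.rpow_sub hpos, le_div_iff₀ (Real.rpow_pos_of_pos hpos p), Real.rpow_two, sq_abs]
    linarith
  rw [one_div]
  exact (Real.rpow_inv_le_iff_of_pos (mul_nonneg (by positivity) (by linarith)) hpos.le
    (by linarith)).mpr hle
end

section
/- Let 0 < p < 1, λ > 0, ν > 0, and z ≥ 0, and define ψ(x) = min{ x^p/ν^p, 1 } for x ≥ 0 (the CapLp function). If x* ≥ 0 is a global minimizer of h(x) = λψ(x) + (1/2)(x − z)² over [0, ∞), then either x* = 0 or x* ≥ min{ (2λ(1−p)/ν^p)^{1/(2−p)}, ν }. (Thresholding property of the capped-ℓ^p proximal operator underlying the support stabilization argument of Theorem 3.8.) -/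
/-- Thresholding property of the capped-`ℓ^p` proximal operator (underlying the support
stabilization argument of Theorem 3.8): with `ψ(x) = min{x^p/ν^p, 1}` (CapLp), if
`x* ≥ 0` globally minimizes `h(x) = λψ(x) + (1/2)(x − z)²` over `[0,∞)`, then `x* = 0`
or `x* ≥ min{(2λ(1−p)/ν^p)^{1/(2−p)}, ν}`. -/
theorem capLp_prox_threshold (p lam nu z : ℝ) (hp0 : 0 < p) (hp1 : p < 1)
    (hlam : 0 < lam) (hnu : 0 < nu) (hz : 0 ≤ z)
    (xstar : ℝ) (hxstar : 0 ≤ xstar)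
    (hmin : ∀ x : ℝ, 0 ≤ x →
      lam * min (xstar ^ p / nu ^ p) 1 + (1 / 2) * (xstar - z) ^ 2 ≤
        lam * min (x ^ p / nu ^ p) 1 + (1 / 2) * (x - z) ^ 2) :
    xstar = 0 ∨ min ((2 * lam * (1 - p) / nu ^ p) ^ ((1 : ℝ) / (2 - p))) nu ≤ xstar := by
  by_cases hs0 : xstar = 0
  · exact Or.inl hs0
  refine Or.inr ?_
  have hs : 0 < xstar := lt_of_le_of_ne hxstar (Ne.symm hs0)
  rcases le_or_gt nu xstar with h | hlt
  · exact (min_le_right _ _).trans h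
  refine (min_le_left _ _).trans ?_
  have hnp : 0 < nu ^ p := Real.rpow_pos_of_pos hnu p
  have hval : min (xstar ^ p / nu ^ p) 1 = xstar ^ p / nu ^ p :=
    min_eq_left ((div_le_one hnp).2 (Real.rpow_le_rpow hxstar hlt.le hp0.le))
  rw [hval] at hmin
  -- first-order optimality at the interior point `xstar`
  have hloc : IsLocalMin (fun x : ℝ => lam * (x ^ p / nu ^ p) + (1 / 2) * (x - z) ^ 2) xstar := by
    filter_upwards [lt_mem_nhds hs] with x hx
    have hle := mul_le_mul_of_nonneg_left (min_le_left (x ^ p / nu ^ p) 1) hlam.le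
    linarith [hmin x hx.le]
  have hder : HasDerivAt (fun x : ℝ => lam * (x ^ p / nu ^ p) + (1 / 2) * (x - z) ^ 2)
      (lam * (p * xstar ^ (p - 1) / nu ^ p) + (xstar - z)) xstar := by
    have hsq := (((hasDerivAt_id xstar).sub_const z).pow 2).const_mul (1 / 2 : ℝ)
    have hpow := ((Real.hasDerivAt_rpow_const (p := p) (Or.inl hs0)).div_const
      (nu ^ p)).const_mul lam
    refine (hpow.add hsq).congr_deriv ?_
    simp
  have hfoc := hloc.hasDerivAt_eq_zero hder
  -- comparison with the origin
  have hzero := hmin 0 le_rfl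
  rw [Real.zero_rpow hp0.ne', zero_div, min_eq_left zero_le_one] at hzero
  have hmul : xstar ^ p = xstar ^ (p - 1) * xstar := by
    rw [← Real.rpow_add_one hs0, sub_add_cancel]
  have hsplit : xstar ^ (2 - p) * xstar ^ p = xstar ^ 2 := by
    rw [← Real.rpow_add hs, sub_add_cancel, Real.rpow_two]
  have hfoc' : lam * (p * xstar ^ p / nu ^ p) = (z - xstar) * xstar := by
    rw [hmul]
    linear_combination xstar * hfoc
  have hkey : 2 * lam * (1 - p) / nu ^ p ≤ xstar ^ (2 - p) := by
    refine le_of_mul_le_mul_right ?_ (Real.rpow_pos_of_pos hs p)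
    rw [hsplit]
    have hrw : 2 * lam * (1 - p) / nu ^ p * xstar ^ p
        = 2 * (lam * (xstar ^ p / nu ^ p)) - 2 * (lam * (p * xstar ^ p / nu ^ p)) := by ring
    rw [hrw, hfoc']
    nlinarith [hzero]
  have hnonneg : 0 ≤ 2 * lam * (1 - p) / nu ^ p :=
    div_nonneg (mul_nonneg (by positivity) (by linarith)) hnp.le
  rw [one_div]
  exact (Real.rpow_inv_le_iff_of_pos hnonneg hxstar (by linarith)).2 hkey
end

section
/- Let H be a real inner product space, let φ : [0,∞) → [0,∞) be nondecreasing, let λ > 0, and let ê ∈ H with ê ≠ 0. If t* ≥ 0 minimizes g(t) = λφ(t) + (1/2)(t − ‖ê‖)² over [0,∞), then the vector x* = (t*/‖ê‖)·ê minimizes the function x ↦ λφ(‖x‖) + (1/2)‖x − ê‖² over all of H. (Reduction of the group proximal subproblems (opt:E1), (opt:Z), (opt:E2) to a scalar problem.) -/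
/-- Reduction of the group proximal subproblems (opt:E1), (opt:Z), (opt:E2) to a scalar
problem: if `φ : [0,∞) → [0,∞)` is nondecreasing, `λ > 0`, `ê ≠ 0`, and `t* ≥ 0`
minimizes `g(t) = λφ(t) + (1/2)(t − ‖ê‖)²` over `[0,∞)`, then `x* = (t*/‖ê‖)·ê`
minimizes `x ↦ λφ(‖x‖) + (1/2)‖x − ê‖²` over the whole space. -/
theorem radial_prox_reduction {H : Type*} [NormedAddCommGroup H] [InnerProductSpace ℝ H]
    (φ : ℝ → ℝ) (hφmono : MonotoneOn φ (Set.Ici 0)) (hφnonneg : ∀ x : ℝ, 0 ≤ x → 0 ≤ φ x)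
    (lam : ℝ) (hlam : 0 < lam) (e : H) (he : e ≠ 0)
    (tstar : ℝ) (htstar : 0 ≤ tstar)
    (hmin : ∀ t : ℝ, 0 ≤ t →
      lam * φ tstar + (1 / 2) * (tstar - ‖e‖) ^ 2 ≤ lam * φ t + (1 / 2) * (t - ‖e‖) ^ 2) :
    ∀ x : H, lam * φ ‖(tstar / ‖e‖) • e‖ + (1 / 2) * ‖(tstar / ‖e‖) • e - e‖ ^ 2 ≤
      lam * φ ‖x‖ + (1 / 2) * ‖x - e‖ ^ 2 := by
  have he' : ‖e‖ ≠ 0 := norm_ne_zero_iff.mpr he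
  have hnorm : ‖(tstar / ‖e‖) • e‖ = tstar := by
    rw [norm_smul, Real.norm_of_nonneg (by positivity), div_mul_cancel₀ _ he']
  have hdist : ‖(tstar / ‖e‖) • e - e‖ ^ 2 = (tstar - ‖e‖) ^ 2 := by
    have hsub : (tstar / ‖e‖) • e - e = ((tstar - ‖e‖) / ‖e‖) • e := by
      rw [sub_div, div_self he', sub_smul, one_smul]
    rw [hsub, norm_smul, mul_pow, Real.norm_eq_abs, sq_abs, ← mul_pow, div_mul_cancel₀ _ he']
  intro x
  have hx : (‖x‖ - ‖e‖) ^ 2 ≤ ‖x - e‖ ^ 2 :=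
    sq_le_sq.mpr ((abs_norm_sub_norm_le x e).trans (le_abs_self _))
  rw [hnorm, hdist]
  linarith [hmin ‖x‖ (norm_nonneg x)]
end

section
/- Let H be a real inner product space, let f : H → ℝ be differentiable with gradient ∇f, and suppose ∇f is Lipschitz continuous with constant ℓ ≥ 0. Let C ⊆ H, let x̄ ∈ C, let ρ > 0, and suppose x⁺ ∈ C minimizes the function x ↦ ⟨∇f(x̄), x − x̄⟩ + ((ℓ + ρ)/2)‖x − x̄‖² over C. Then f(x⁺) + (ρ/2)‖x⁺ − x̄‖² ≤ f(x̄). (Sufficient decrease of one prox-linear step, the argument establishing inequalities (CA:C-1)–(CA:C) in Lemma 3.5(1).) -/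
open scoped RealInnerProductSpace

/-- The descent lemma: a function with `l`-Lipschitz gradient `g` is bounded above by its
first-order expansion plus `l / 2` times the squared distance. -/
theorem le_linear_add_sq_of_lipschitz_gradient {H : Type*} [NormedAddCommGroup H]
    [InnerProductSpace ℝ H] {f : H → ℝ} {g : H → H}
    (hgrad : ∀ x : H, HasFDerivAt f (InnerProductSpace.toDualMap ℝ H (g x)) x)
    {l : ℝ} (hlip : ∀ x y : H, ‖g x - g y‖ ≤ l * ‖x - y‖) (x y : H) :
    f y ≤ f x + ⟪g x, y - x⟫ + l / 2 * ‖y - x‖ ^ 2 := by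
  have hf : ∀ t : ℝ, HasDerivAt (fun s : ℝ => f (x + s • (y - x)))
      ⟪g (x + t • (y - x)), y - x⟫ t := fun t => by
    have hline : HasDerivAt (fun s : ℝ => x + s • (y - x)) (y - x) t := by
      simpa using ((hasDerivAt_id t).smul_const (y - x)).const_add x
    exact (hgrad (x + t • (y - x))).comp_hasDerivAt t hline
  have hB : ∀ t : ℝ, HasDerivAt
      (fun s : ℝ => f x + s * ⟪g x, y - x⟫ + l / 2 * ‖y - x‖ ^ 2 * s ^ 2)
      (⟪g x, y - x⟫ + l * ‖y - x‖ ^ 2 * t) t := fun t => by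
    have h := (((hasDerivAt_id t).mul_const ⟪g x, y - x⟫).const_add (f x)).add
      (((hasDerivAt_id t).pow 2).const_mul (l / 2 * ‖y - x‖ ^ 2))
    refine h.congr_deriv ?_
    simp only [id_eq]
    ring
  have key := image_le_of_deriv_right_le_deriv_boundary (a := 0) (b := 1)
    (fun t _ => (hf t).continuousAt.continuousWithinAt) (fun t _ => (hf t).hasDerivWithinAt)
    (by simp) (fun t _ => (hB t).continuousAt.continuousWithinAt)
    (fun t _ => (hB t).hasDerivWithinAt) (fun t ht => by
      have h : ⟪g (x + t • (y - x)) - g x, y - x⟫ ≤ l * ‖y - x‖ ^ 2 * t := calc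
        _ ≤ ‖g (x + t • (y - x)) - g x‖ * ‖y - x‖ := real_inner_le_norm _ _
        _ ≤ l * ‖x + t • (y - x) - x‖ * ‖y - x‖ := by gcongr; exact hlip _ _
        _ = l * ‖y - x‖ ^ 2 * t := by
          rw [add_sub_cancel_left, norm_smul, Real.norm_of_nonneg ht.1]
          ring
      rw [inner_sub_left] at h
      linarith) (Set.right_mem_Icc.2 zero_le_one)
  simpa using key

/-- Sufficient decrease of one prox-linear step (the argument establishing
(CA:C-1)–(CA:C) in Lemma 3.5(1)): if `f` is differentiable with `ℓ`-Lipschitz gradient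
`g`, `x̄ ∈ C`, `ρ > 0`, and `x⁺ ∈ C` minimizes
`x ↦ ⟨g(x̄), x − x̄⟩ + ((ℓ+ρ)/2)‖x − x̄‖²` over `C`, then
`f(x⁺) + (ρ/2)‖x⁺ − x̄‖² ≤ f(x̄)`. -/
theorem prox_linear_sufficient_decrease {H : Type*} [NormedAddCommGroup H]
    [InnerProductSpace ℝ H]
    (f : H → ℝ) (g : H → H)
    (hgrad : ∀ x : H, HasFDerivAt f (InnerProductSpace.toDualMap ℝ H (g x)) x)
    (l : ℝ) (hl : 0 ≤ l) (hlip : ∀ x y : H, ‖g x - g y‖ ≤ l * ‖x - y‖)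
    (C : Set H) (xbar : H) (hxbar : xbar ∈ C) (ρ : ℝ) (hρ : 0 < ρ)
    (xplus : H) (hxplus : xplus ∈ C)
    (hmin : ∀ x ∈ C, ⟪g xbar, xplus - xbar⟫ + ((l + ρ) / 2) * ‖xplus - xbar‖ ^ 2 ≤
      ⟪g xbar, x - xbar⟫ + ((l + ρ) / 2) * ‖x - xbar‖ ^ 2) :
    f xplus + (ρ / 2) * ‖xplus - xbar‖ ^ 2 ≤ f xbar := by
  have hdesc := le_linear_add_sq_of_lipschitz_gradient hgrad hlip xbar xplus
  have hle := hmin xbar hxbar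
  simp only [sub_self, inner_zero_right, norm_zero] at hle
  linarith
end
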